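/- For any Finsler metric F on an open set U ⊆ ℝⁿ (n ≥ 2), for every x ∈ U, y ∈ ℝⁿ ∖ {0} and v ∈ ℝⁿ, the vertical derivative of the Riemann curvature tensor satisfies [R_{ij}]_{y^k} v^iv^jv^k = C_{ijm}v^iv^j R^m_k v^k − C_{ijk|0|0}v^iv^jv^k, all tensors being evaluated at (x, y). -/

import Mathlib

open scoped BigOperators
open MeasureTheory

noncomputable section

namespace Paper

/-- `E n` is the model space ℝⁿ. -/
abbrev E (n : ℕ) := Fin n → ℝ

/-- `e n i` is the `i`-th standard basis vector of ℝⁿ. -/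
def e (n : ℕ) (i : Fin n) : E n := Pi.single i 1

/-- Partial derivative of `f(x,y)` in the fiber variable `y^i`. -/
def pdy (n : ℕ) (f : E n → E n → ℝ) (i : Fin n) : E n → E n → ℝ :=
  fun x y => fderiv ℝ (f x) y (e n i)

/-- Partial derivative of `f(x,y)` in the base variable `x^k`. -/
def pdx (n : ℕ) (f : E n → E n → ℝ) (k : Fin n) : E n → E n → ℝ :=
  fun x y => fderiv ℝ (fun x' => f x' y) x (e n k)

/-- The square `F²` of the metric. -/
def F2 (n : ℕ) (F : E n → E n → ℝ) : E n → E n → ℝ := fun x y => (F x y) ^ 2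

/-- Fundamental tensor `g_{ij} = ½ [F²]_{y^i y^j}`. -/
def gm (n : ℕ) (F : E n → E n → ℝ) (i j : Fin n) : E n → E n → ℝ :=
  fun x y => (1 / 2 : ℝ) * pdy n (pdy n (F2 n F) j) i x y

/-- The fundamental tensor as a matrix. -/
def gmat (n : ℕ) (F : E n → E n → ℝ) (x y : E n) : Matrix (Fin n) (Fin n) ℝ :=
  Matrix.of fun i j => gm n F i j x y

/-- The inverse fundamental tensor `g^{ij}`. -/
def ginv (n : ℕ) (F : E n → E n → ℝ) (x y : E n) : Matrix (Fin n) (Fin n) ℝ :=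
  (gmat n F x y)⁻¹

/-- `F_{y^i}`. -/
def Fy (n : ℕ) (F : E n → E n → ℝ) (i : Fin n) : E n → E n → ℝ := pdy n F i

/-- Angular metric `h_{ij} = g_{ij} - F_{y^i} F_{y^j}`. -/
def hm (n : ℕ) (F : E n → E n → ℝ) (i j : Fin n) : E n → E n → ℝ :=
  fun x y => gm n F i j x y - Fy n F i x y * Fy n F j x y

/-- Cartan tensor `C_{ijk} = ¼ [F²]_{y^i y^j y^k}`. -/
def Cartan (n : ℕ) (F : E n → E n → ℝ) (i j k : Fin n) : E n → E n → ℝ :=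
  fun x y => (1 / 4 : ℝ) * pdy n (pdy n (pdy n (F2 n F) k) j) i x y

/-- Mean Cartan tensor `I_i = g^{jk} C_{ijk}`. -/
def meanCartan (n : ℕ) (F : E n → E n → ℝ) (i : Fin n) : E n → E n → ℝ :=
  fun x y => ∑ j, ∑ k, ginv n F x y j k * Cartan n F i j k x y

/-- Matsumoto torsion `M_{ijk}`. -/
def Matsumoto (n : ℕ) (F : E n → E n → ℝ) (i j k : Fin n) : E n → E n → ℝ :=
  fun x y => Cartan n F i j k x y -
    (1 / ((n : ℝ) + 1)) * (hm n F i j x y * meanCartan n F k x y +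
      hm n F j k x y * meanCartan n F i x y + hm n F k i x y * meanCartan n F j x y)

/-- Spray coefficients `G^i = ¼ g^{il} ([F²]_{x^k y^l} y^k - [F²]_{x^l})`. -/
def Spray (n : ℕ) (F : E n → E n → ℝ) (i : Fin n) : E n → E n → ℝ :=
  fun x y => (1 / 4 : ℝ) * ∑ l, ginv n F x y i l *
    ((∑ k, pdx n (pdy n (F2 n F) l) k x y * y k) - pdx n (F2 n F) l x y)

/-- Riemann curvature `R^i_k`. -/
def RiemUp (n : ℕ) (F : E n → E n → ℝ) (i k : Fin n) : E n → E n → ℝ :=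
  fun x y =>
    2 * pdx n (Spray n F i) k x y
    - (∑ j, y j * pdx n (pdy n (Spray n F i) k) j x y)
    + 2 * (∑ j, Spray n F j x y * pdy n (pdy n (Spray n F i) k) j x y)
    - ∑ j, pdy n (Spray n F i) j x y * pdy n (Spray n F j) k x y

/-- Riemann curvature with lowered index `R_{jk} = g_{ij} R^i_k`. -/
def Rlow (n : ℕ) (F : E n → E n → ℝ) (j k : Fin n) : E n → E n → ℝ :=
  fun x y => ∑ i, gm n F i j x y * RiemUp n F i k x y

/-- Flag curvature `K(x,y,v)`. -/
def K (n : ℕ) (F : E n → E n → ℝ) (x y v : E n) : ℝ :=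
  (∑ j, ∑ k, Rlow n F j k x y * v j * v k) /
    ((F x y) ^ 2 * ∑ j, ∑ k, hm n F j k x y * v j * v k)

/-- `F` is a Finsler metric on the open set `U ⊆ ℝⁿ`. -/
structure IsFinsler (n : ℕ) (U : Set (E n)) (F : E n → E n → ℝ) : Prop where
  smooth : ContDiffOn ℝ (⊤ : ℕ∞) (fun p : E n × E n => F p.1 p.2) (U ×ˢ {y : E n | y ≠ 0})
  pos : ∀ x ∈ U, ∀ y : E n, y ≠ 0 → 0 < F x y
  homog : ∀ x ∈ U, ∀ y : E n, y ≠ 0 → ∀ c : ℝ, 0 < c → F x (c • y) = c * F x y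
  posdef : ∀ x ∈ U, ∀ y : E n, y ≠ 0 → (gmat n F x y).PosDef

/-- `F` is of sectional flag curvature: `K` only depends on the section. -/
def SectionalFlagCurv (n : ℕ) (U : Set (E n)) (F : E n → E n → ℝ) : Prop :=
  ∀ x ∈ U, ∀ y v y' v' : E n,
    LinearIndependent ℝ ![y, v] → LinearIndependent ℝ ![y', v'] →
    Submodule.span ℝ {y, v} = Submodule.span ℝ {y', v'} →
    K n F x y v = K n F x y' v'

/-- The flag curvature is isotropic at `x`. -/
def IsotropicAt (n : ℕ) (F : E n → E n → ℝ) (x : E n) : Prop :=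
  ∃ c : ℝ, ∀ y v : E n, LinearIndependent ℝ ![y, v] → K n F x y v = c

/-- The spray vector field `G = y^i ∂/∂x^i - 2G^i ∂/∂y^i` acting on a function of `(x,y)`. -/
def Gop (n : ℕ) (F f : E n → E n → ℝ) : E n → E n → ℝ :=
  fun x y => (∑ i, y i * pdx n f i x y) - 2 * ∑ i, Spray n F i x y * pdy n f i x y

/-- Dynamical derivative of a 1-index tensor. -/
def Dyn1 (n : ℕ) (F : E n → E n → ℝ) (T : Fin n → E n → E n → ℝ) (i : Fin n) :
    E n → E n → ℝ :=
  fun x y => Gop n F (T i) x y - ∑ m, pdy n (Spray n F m) i x y * T m x y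

/-- Dynamical derivative of a 2-index tensor. -/
def Dyn2 (n : ℕ) (F : E n → E n → ℝ) (T : Fin n → Fin n → E n → E n → ℝ) (i j : Fin n) :
    E n → E n → ℝ :=
  fun x y => Gop n F (T i j) x y - (∑ m, pdy n (Spray n F m) i x y * T m j x y)
    - ∑ m, pdy n (Spray n F m) j x y * T i m x y

/-- Dynamical derivative of a 3-index tensor. -/
def Dyn3 (n : ℕ) (F : E n → E n → ℝ) (T : Fin n → Fin n → Fin n → E n → E n → ℝ)
    (i j k : Fin n) : E n → E n → ℝ :=
  fun x y => Gop n F (T i j k) x y - (∑ m, pdy n (Spray n F m) i x y * T m j k x y)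
    - (∑ m, pdy n (Spray n F m) j x y * T i m k x y)
    - ∑ m, pdy n (Spray n F m) k x y * T i j m x y

/-- `y` is a polar direction at `x`: `R_{jk} = κ F² h_{jk}` for some constant `κ`. -/
def IsPolarDir (n : ℕ) (F : E n → E n → ℝ) (x y : E n) : Prop :=
  ∃ κ : ℝ, ∀ j k : Fin n, Rlow n F j k x y = κ * (F x y) ^ 2 * hm n F j k x y


section Alg

set_option linter.unusedSectionVars false

variable {ι A : Type*} [Fintype ι] [CommRing A] [Algebra ℝ A]

def T2 (g : ι → ι → A) (a b : ι → A) : A := ∑ i, ∑ j, g i j * a i * b j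
def T3 (C : ι → ι → ι → A) (a b c : ι → A) : A := ∑ i, ∑ j, ∑ k, C i j k * a i * b j * c k
def ap (N : ι → ι → A) (a : ι → A) : ι → A := fun m => ∑ j, N m j * a j
def bap (B : ι → ι → ι → A) (a b : ι → A) : ι → A := fun m => ∑ k, ∑ l, B m k l * a k * b l

lemma T3_comb2 (P Q : ι → ι → ι → A) (a b c : ι → A) :
    T3 (fun i j k => P i j k + Q i j k) a b c = T3 P a b c + T3 Q a b c := by
  simp only [T3, add_mul, Finset.sum_add_distrib]

lemma T3_sub (P Q : ι → ι → ι → A) (a b c : ι → A) :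
    T3 (fun i j k => P i j k - Q i j k) a b c = T3 P a b c - T3 Q a b c := by
  simp only [T3, sub_mul, Finset.sum_sub_distrib]

lemma T3_mul (r : A) (P : ι → ι → ι → A) (a b c : ι → A) :
    T3 (fun i j k => r * P i j k) a b c = r * T3 P a b c := by
  simp only [T3, Finset.mul_sum, mul_assoc]

lemma T3_N1 (N : ι → ι → A) (C : ι → ι → ι → A) (a b c : ι → A) :
    T3 (fun i j k => ∑ m, N m i * C m j k) a b c = T3 C (ap N a) b c := by
  simp only [T3, ap, Finset.sum_mul, Finset.mul_sum]
  calc _ = ∑ i, ∑ m, ∑ j, ∑ k, N m i * C m j k * a i * b j * c k := by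
        refine Finset.sum_congr rfl fun i _ => ?_
        rw [Finset.sum_comm]
        conv_rhs => rw [Finset.sum_comm]
        rw [Finset.sum_comm]
        refine Finset.sum_congr rfl fun j _ => ?_
        rw [Finset.sum_comm]
    _ = _ := by
        rw [Finset.sum_comm]
        refine Finset.sum_congr rfl fun m _ => ?_
        rw [Finset.sum_comm]
        refine Finset.sum_congr rfl fun j _ => ?_
        rw [Finset.sum_comm]
        refine Finset.sum_congr rfl fun k _ => ?_
        refine Finset.sum_congr rfl fun i _ => ?_
        ring

lemma T3_swap12 (C : ι → ι → ι → A) (a b c : ι → A) :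
    T3 (fun i j k => C j i k) a b c = T3 C b a c := by
  simp only [T3]
  rw [Finset.sum_comm]
  refine Finset.sum_congr rfl fun i _ => Finset.sum_congr rfl fun j _ =>
    Finset.sum_congr rfl fun k _ => by ring

lemma T3_swap23 (C : ι → ι → ι → A) (a b c : ι → A) :
    T3 (fun i j k => C i k j) a b c = T3 C a c b := by
  simp only [T3]
  refine Finset.sum_congr rfl fun i _ => ?_
  rw [Finset.sum_comm]
  refine Finset.sum_congr rfl fun j _ =>
    Finset.sum_congr rfl fun k _ => by ring

lemma T3_N2 (N : ι → ι → A) (C : ι → ι → ι → A) (a b c : ι → A) :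
    T3 (fun i j k => ∑ m, N m j * C i m k) a b c = T3 C a (ap N b) c := by
  rw [← T3_swap12 C, ← T3_N1, ← T3_swap12]

lemma T3_N3 (N : ι → ι → A) (C : ι → ι → ι → A) (a b c : ι → A) :
    T3 (fun i j k => ∑ m, N m k * C i j m) a b c = T3 C a b (ap N c) := by
  rw [← T3_swap23 C, ← T3_N2, ← T3_swap23]

lemma T3_B1 (B : ι → ι → ι → A) (g : ι → ι → A) (a b c : ι → A) :
    T3 (fun i j k => ∑ m, B m i k * g m j) a b c = T2 g (bap B a c) b := by
  simp only [T3, T2, bap, Finset.sum_mul, Finset.mul_sum]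
  calc _ = ∑ j, ∑ i, ∑ m, ∑ k, B m i k * g m j * a i * b j * c k := by
        rw [Finset.sum_comm]
        refine Finset.sum_congr rfl fun j _ => ?_
        refine Finset.sum_congr rfl fun i _ => ?_
        rw [Finset.sum_comm]
    _ = ∑ j, ∑ m, ∑ i, ∑ k, B m i k * g m j * a i * b j * c k := by
        refine Finset.sum_congr rfl fun j _ => ?_
        rw [Finset.sum_comm]
    _ = _ := by
        rw [Finset.sum_comm]
        refine Finset.sum_congr rfl fun m _ => ?_
        refine Finset.sum_congr rfl fun j _ => ?_
        refine Finset.sum_congr rfl fun k _ => ?_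
        refine Finset.sum_congr rfl fun i _ => ?_
        ring

lemma T3_B2 (B : ι → ι → ι → A) (g : ι → ι → A) (a b c : ι → A) :
    T3 (fun i j k => ∑ m, B m j k * g m i) a b c = T2 g (bap B b c) a := by
  rw [← T3_B1, ← T3_swap12]

lemma T2_N (N g : ι → ι → A) (a b : ι → A) :
    T2 (fun i j => ∑ m, N m i * g m j) a b = T2 g (ap N a) b := by
  simp only [T2, ap, Finset.sum_mul, Finset.mul_sum]
  calc _ = ∑ j, ∑ m, ∑ i, N m i * g m j * a i * b j := by
        rw [Finset.sum_comm]
        refine Finset.sum_congr rfl fun j _ => ?_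
        rw [Finset.sum_comm]
    _ = _ := by
        rw [Finset.sum_comm]
        refine Finset.sum_congr rfl fun m _ => ?_
        refine Finset.sum_congr rfl fun j _ => ?_
        refine Finset.sum_congr rfl fun k _ => ?_
        ring

lemma T2_swap (g : ι → ι → A) (a b : ι → A) :
    T2 (fun i j => g j i) a b = T2 g b a := by
  simp only [T2]
  rw [Finset.sum_comm]
  refine Finset.sum_congr rfl fun i _ => Finset.sum_congr rfl fun j _ => by ring

lemma T2_comb2 (P Q : ι → ι → A) (a b : ι → A) :
    T2 (fun i j => P i j + Q i j) a b = T2 P a b + T2 Q a b := by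
  simp only [T2, add_mul, Finset.sum_add_distrib]

lemma T3_der (D : Derivation ℝ A A) (C : ι → ι → ι → A) (a b c : ι → A) :
    D (T3 C a b c) = T3 (fun i j k => D (C i j k)) a b c + T3 C (fun i => D (a i)) b c
      + T3 C a (fun i => D (b i)) c + T3 C a b (fun i => D (c i)) := by
  simp only [T3, map_sum, ← Finset.sum_add_distrib, Derivation.leibniz, smul_eq_mul]
  refine Finset.sum_congr rfl fun i _ => Finset.sum_congr rfl fun j _ =>
    Finset.sum_congr rfl fun k _ => by ring

lemma T2_der (D : Derivation ℝ A A) (g : ι → ι → A) (a b : ι → A) :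
    D (T2 g a b) = T2 (fun i j => D (g i j)) a b + T2 g (fun i => D (a i)) b
      + T2 g a (fun i => D (b i)) := by
  simp only [T2, map_sum, ← Finset.sum_add_distrib, Derivation.leibniz, smul_eq_mul]
  refine Finset.sum_congr rfl fun i _ => Finset.sum_congr rfl fun j _ => by ring

lemma T3_zero3 (C : ι → ι → ι → A) (a b : ι → A) : T3 C a b (fun _ => 0) = 0 := by simp [T3]
lemma T3_zero2 (C : ι → ι → ι → A) (a b : ι → A) : T3 C a (fun _ => 0) b = 0 := by simp [T3]
lemma T3_zero1 (C : ι → ι → ι → A) (a b : ι → A) : T3 C (fun _ => 0) a b = 0 := by simp [T3]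
lemma T2_zero2 (C : ι → ι → A) (a : ι → A) : T2 C a (fun _ => 0) = 0 := by simp [T2]

lemma T3_comb (C : ι → ι → ι → A) (a b p q r : ι → A) :
    T3 C (fun m => 2 * p m - q m - r m) a b
      = 2 * T3 C p a b - T3 C q a b - T3 C r a b := by
  simp only [T3, Finset.mul_sum, ← Finset.sum_sub_distrib]
  refine Finset.sum_congr rfl fun i _ => Finset.sum_congr rfl fun j _ =>
    Finset.sum_congr rfl fun k _ => by ring

lemma T2_comb (g : ι → ι → A) (a p q r s : ι → A) :
    T2 g (fun m => p m - q m + r m - s m) a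
      = T2 g p a - T2 g q a + T2 g r a - T2 g s a := by
  simp only [T2, ← Finset.sum_sub_distrib, ← Finset.sum_add_distrib]
  refine Finset.sum_congr rfl fun i _ => Finset.sum_congr rfl fun j _ => by ring

lemma ap_der (D : Derivation ℝ A A) (N : ι → ι → A) (a : ι → A) (ha : ∀ i, D (a i) = 0) :
    (fun m => D (ap N a m)) = ap (fun m j => D (N m j)) a := by
  funext m
  simp [ap, map_sum, Derivation.leibniz, ha, mul_comm]

lemma bap_der (D : Derivation ℝ A A) (B : ι → ι → ι → A) (a : ι → A) (ha : ∀ i, D (a i) = 0) :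
    (fun m => D (bap B a a m)) = bap (fun m k l => D (B m k l)) a a := by
  funext m
  simp only [bap, map_sum, Derivation.leibniz, ha, smul_eq_mul, mul_zero, zero_add]
  refine Finset.sum_congr rfl fun i _ => Finset.sum_congr rfl fun j _ => by ring

/-- The algebraic core: everything follows from `∇ g = 0` and the commutators. -/
theorem alg_core (dx dy : ι → Derivation ℝ A A) (G : Derivation ℝ A A)
    (S : ι → A) (N : ι → ι → A) (B : ι → ι → ι → A) (g : ι → ι → A) (C C1 C2 : ι → ι → ι → A)
    (R Rl : ι → ι → A) (v : ι → A)
    (hvG : ∀ i, G (v i) = 0)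
    (hyx : ∀ i j f, dy i (dx j f) = dx j (dy i f))
    (hyG : ∀ k f, dy k (G f) = G (dy k f) + dx k f - 2 * ∑ m, N m k * dy m f)
    (hxG : ∀ k f, dx k (G f) = G (dx k f) - 2 * ∑ m, dx k (S m) * dy m f)
    (hN : ∀ m i, dy i (S m) = N m i) (hB : ∀ m i k, dy k (N m i) = B m i k)
    (hBs : ∀ m i k, B m i k = B m k i)
    (hgs : ∀ i j, g i j = g j i)
    (hC : ∀ i j k, dy k (g i j) = 2 * C i j k)
    (hC12 : ∀ i j k, C i j k = C j i k) (hC23 : ∀ i j k, C i j k = C i k j)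
    (hGg : ∀ i j, G (g i j) = (∑ m, N m i * g m j) + ∑ m, N m j * g m i)
    (hC1 : ∀ i j k, C1 i j k = G (C i j k) - (∑ m, N m i * C m j k)
      - (∑ m, N m j * C i m k) - ∑ m, N m k * C i j m)
    (hC2 : ∀ i j k, C2 i j k = G (C1 i j k) - (∑ m, N m i * C1 m j k)
      - (∑ m, N m j * C1 i m k) - ∑ m, N m k * C1 i j m)
    (hR : ∀ m k, R m k = 2 * dx k (S m) - G (N m k) - ∑ j, N m j * N j k)
    (hRl : ∀ j k, Rl j k = ∑ i, g i j * R i k) :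
    2 * T3 (fun i j k => dy k (Rl i j)) v v v = 2 * (T3 C v v (ap R v) - T3 C2 v v v) := by
  have s12 : ∀ a b c, T3 C a b c = T3 C b a c := fun a b c => by
    rw [← T3_swap12 C]; congr; funext i j k; exact hC12 _ _ _
  have s23 : ∀ a b c, T3 C a b c = T3 C a c b := fun a b c => by
    rw [← T3_swap23 C]; congr; funext i j k; exact hC23 _ _ _
  have sg : ∀ a b, T2 g a b = T2 g b a := fun a b => by
    rw [← T2_swap g]; congr; funext i j; exact hgs _ _
  set GC : ι → ι → ι → A := fun i j k => G (C i j k) with hGCdef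
  have sGC : ∀ a b c, T3 GC a b c = T3 GC b a c := fun a b c => by
    rw [← T3_swap12 GC]; congr; funext i j k; simp only [hGCdef]; rw [hC12]
  have sGC2 : ∀ a b c, T3 GC a b c = T3 GC a c b := fun a b c => by
    rw [← T3_swap23 GC]; congr; funext i j k; simp only [hGCdef]; rw [hC23]
  set Xg : ι → ι → ι → A := fun i j k => dx k (g i j) with hXgdef
  have sXg : ∀ a b c, T3 Xg a b c = T3 Xg b a c := fun a b c => by
    rw [← T3_swap12 Xg]; congr; funext i j k; simp only [hXgdef]; rw [hgs]
  have sB : ∀ a b, bap B a b = bap B b a := fun a b => by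
    funext m
    simp only [bap]
    rw [Finset.sum_comm]
    refine Finset.sum_congr rfl fun i _ => Finset.sum_congr rfl fun j _ => ?_
    rw [hBs]; ring
  -- vertical derivative of `∇ g = 0`
  have K : ∀ a b c, 2 * T3 GC a b c + T3 Xg a b c - 4 * T3 C a b (ap N c)
      = 2 * T3 C (ap N a) b c + 2 * T3 C a (ap N b) c + T2 g (bap B a c) b
        + T2 g (bap B b c) a := by
    intro a b c
    have h0 : (fun i j k => 2 * GC i j k + Xg i j k - 4 * ∑ m, N m k * C i j m)
        = fun i j k => 2 * (∑ m, N m i * C m j k) + 2 * (∑ m, N m j * C i m k)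
          + (∑ m, B m i k * g m j) + ∑ m, B m j k * g m i := by
      funext i j k
      have h1 := hyG k (g i j)
      have h2 : G (2 * C i j k) = 2 * GC i j k := by
        rw [two_mul, map_add, two_mul]
      rw [hGg, hC i j k, h2] at h1
      simp only [map_add, map_sum, Derivation.leibniz, smul_eq_mul, hB, hC,
        Finset.sum_add_distrib] at h1
      have e1 : ∑ m, N m k * (2 * C i j m) = 2 * ∑ m, N m k * C i j m := by
        rw [Finset.mul_sum]; exact Finset.sum_congr rfl fun m _ => by ring
      have e2 : ∑ m, N m i * (2 * C m j k) = 2 * ∑ m, N m i * C m j k := by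
        rw [Finset.mul_sum]; exact Finset.sum_congr rfl fun m _ => by ring
      have e3 : ∑ m, N m j * (2 * C m i k) = 2 * ∑ m, N m j * C i m k := by
        rw [Finset.mul_sum]; exact Finset.sum_congr rfl fun m _ => by rw [hC12 m i k]; ring
      have e4 : ∑ m, g m j * B m i k = ∑ m, B m i k * g m j :=
        Finset.sum_congr rfl fun m _ => by ring
      have e5 : ∑ m, g m i * B m j k = ∑ m, B m j k * g m i :=
        Finset.sum_congr rfl fun m _ => by ring
      rw [e1, e2, e3, e4, e5] at h1
      simp only [hXgdef]
      linear_combination -h1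
    have h3 := congrArg (fun T => T3 T a b c) h0
    simp only [T3_comb2, T3_sub, T3_mul, T3_N1, T3_N2, T3_N3, T3_B1, T3_B2] at h3
    exact h3
  have hC1c : ∀ a b c, T3 C1 a b c = T3 GC a b c - T3 C (ap N a) b c - T3 C a (ap N b) c
      - T3 C a b (ap N c) := by
    intro a b c
    have : C1 = fun i j k => GC i j k - (∑ m, N m i * C m j k)
      - (∑ m, N m j * C i m k) - ∑ m, N m k * C i j m := by
      funext i j k; exact hC1 i j k
    rw [this, T3_sub, T3_sub, T3_sub, T3_N1, T3_N2, T3_N3]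
  have hC2c : ∀ a b c, T3 C2 a b c = T3 (fun i j k => G (C1 i j k)) a b c
      - T3 C1 (ap N a) b c - T3 C1 a (ap N b) c - T3 C1 a b (ap N c) := by
    intro a b c
    have : C2 = fun i j k => G (C1 i j k) - (∑ m, N m i * C1 m j k)
      - (∑ m, N m j * C1 i m k) - ∑ m, N m k * C1 i j m := by
      funext i j k; exact hC2 i j k
    rw [this, T3_sub, T3_sub, T3_sub, T3_N1, T3_N2, T3_N3]
  set w := ap N v with hw
  set q := bap B v v with hq
  -- `G` applied to the contracted first dynamical derivative
  have hGv : (fun i => G (v i)) = fun _ => 0 := funext hvG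
  have hG1 : 2 * T3 (fun i j k => G (C1 i j k)) v v v =
      2 * (T3 GC w v v + T3 C (ap (fun m j => G (N m j)) v) v v)
      + 2 * (T2 (fun i j => G (g i j)) q v + T2 g (bap (fun m k l => G (B m k l)) v v) v)
      - T3 (fun i j k => G (Xg i j k)) v v v := by
    have h1 : 2 * T3 C1 v v v = 2 * T3 C w v v + 2 * T2 g q v - T3 Xg v v v := by
      rw [hC1c]
      have := K v v v
      rw [s12 v w v, s23 v v w, s12 v w v] at *
      linear_combination this
    have h2 := congrArg G h1
    have t2 : ∀ f, G (2 * f) = 2 * G f := fun f => by rw [two_mul, map_add, two_mul]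
    simp only [map_sub, map_add, t2, T3_der, T2_der, hGv, T3_zero1, T3_zero2, T3_zero3,
      T2_zero2, add_zero] at h2
    rw [hw, ap_der G N v hvG, hq, bap_der G B v hvG] at h2
    exact h2
  have hGgc : T2 (fun i j => G (g i j)) q v = T2 g (ap N q) v + T2 g w q := by
    have : (fun i j => G (g i j)) = fun i j => (∑ m, N m i * g m j) + ∑ m, N m j * g m i := by
      funext i j; exact hGg i j
    rw [this, T2_comb2, T2_N]
    congr 1
    rw [hw, ← T2_N, ← T2_swap]
  have hGX : T3 (fun i j k => G (Xg i j k)) v v v =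
      2 * T3 Xg w v v + 2 * T2 g (bap (fun m k l => dx l (N m k)) v v) v
        + 4 * T3 C v v (ap (fun m k => dx k (S m)) v) := by
    have h0 : (fun i j k => G (Xg i j k)) = fun i j k =>
        (∑ m, N m i * Xg m j k) + (∑ m, dx k (N m i) * g m j)
        + (∑ m, N m j * Xg i m k) + (∑ m, dx k (N m j) * g m i)
        + 4 * ∑ m, dx k (S m) * C i j m := by
      funext i j k
      have h1 := hxG k (g i j)
      rw [hGg] at h1
      simp only [map_add, map_sum, Derivation.leibniz, smul_eq_mul, hC,
        Finset.sum_add_distrib] at h1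
      have e1 : ∑ m, dx k (S m) * (2 * C i j m) = 2 * ∑ m, dx k (S m) * C i j m := by
        rw [Finset.mul_sum]; exact Finset.sum_congr rfl fun m _ => by ring
      have e4 : ∑ m, g m j * dx k (N m i) = ∑ m, dx k (N m i) * g m j :=
        Finset.sum_congr rfl fun m _ => by ring
      have e5 : ∑ m, g m i * dx k (N m j) = ∑ m, dx k (N m j) * g m i :=
        Finset.sum_congr rfl fun m _ => by ring
      have e6 : ∑ m, N m j * dx k (g m i) = ∑ m, N m j * dx k (g i m) :=
        Finset.sum_congr rfl fun m _ => by rw [hgs]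
      rw [e1, e4, e5, e6] at h1
      simp only [hXgdef]
      linear_combination -h1
    rw [h0]
    simp only [T3_comb2, T3_mul]
    rw [T3_N1, T3_N2, T3_B1 (fun m i k => dx k (N m i)), T3_B2 (fun m i k => dx k (N m i)),
      T3_N3 (fun m k => dx k (S m)), ← hw, sXg v w v]
    ring
  -- the curvature
  have hRv : ap R v = fun m => 2 * ap (fun m k => dx k (S m)) v m
      - ap (fun m j => G (N m j)) v m - ap N w m := by
    funext m
    have : ap N w m = ∑ k, (∑ j, N m j * N j k) * v k := by
      simp only [hw, ap, Finset.sum_mul, Finset.mul_sum]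
      rw [Finset.sum_comm]
      exact Finset.sum_congr rfl fun i _ => Finset.sum_congr rfl fun j _ => by ring
    rw [this]
    simp only [ap, Finset.mul_sum, ← Finset.sum_sub_distrib, hR]
    refine Finset.sum_congr rfl fun i _ => ?_
    ring
  have hVR : bap (fun m k l => dy l (R m k)) v v = fun m =>
      bap (fun m k l => dx l (N m k)) v v m - bap (fun m k l => G (B m k l)) v v m
      + bap B w v m - ap N q m := by
    have key : ∀ m k l, dy l (R m k) = 2 * dx k (N m l) - dx l (N m k) - G (B m k l)
        + 2 * (∑ p, N p l * B m k p) - (∑ j, B m j l * N j k) - ∑ j, N m j * B j k l := by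
      intro m k l
      rw [hR, map_sub, map_sub, hyG]
      have t2 : dy l (2 * dx k (S m)) = 2 * dx k (N m l) := by
        rw [two_mul, map_add, two_mul, hyx, hN]
      simp only [t2, hB, map_sum, Derivation.leibniz, smul_eq_mul, Finset.sum_add_distrib]
      have e1 : ∑ j, N j k * B m j l = ∑ j, B m j l * N j k :=
        Finset.sum_congr rfl fun m _ => by ring
      rw [e1]; ring
    funext m
    have a1 : bap (fun m k l => dx k (N m l)) v v m = bap (fun m k l => dx l (N m k)) v v m := by
      simp only [bap]
      rw [Finset.sum_comm]
      exact Finset.sum_congr rfl fun i _ => Finset.sum_congr rfl fun j _ => by ring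
    have a2 : bap (fun m k l => ∑ p, N p l * B m k p) v v m = bap B v w m := by
      simp only [bap, hw, ap, Finset.sum_mul, Finset.mul_sum]
      refine Finset.sum_congr rfl fun i _ => ?_
      rw [Finset.sum_comm]
      exact Finset.sum_congr rfl fun i _ => Finset.sum_congr rfl fun j _ => by ring
    have a3 : bap (fun m k l => ∑ j, B m j l * N j k) v v m = bap B w v m := by
      simp only [bap, hw, ap, Finset.sum_mul, Finset.mul_sum]
      rw [Finset.sum_comm]
      conv_rhs => rw [Finset.sum_comm]
      refine Finset.sum_congr rfl fun i _ => ?_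
      rw [Finset.sum_comm]
      exact Finset.sum_congr rfl fun i _ => Finset.sum_congr rfl fun j _ => by ring
    have a4 : bap (fun m k l => ∑ j, N m j * B j k l) v v m = ap N q m := by
      simp only [bap, hq, ap, Finset.sum_mul, Finset.mul_sum]
      conv_rhs => rw [Finset.sum_comm]
      refine Finset.sum_congr rfl fun i _ => ?_
      rw [Finset.sum_comm]
      exact Finset.sum_congr rfl fun i _ => Finset.sum_congr rfl fun j _ => by ring
    have a5 : bap (fun m k l => dy l (R m k)) v v m =
        2 * bap (fun m k l => dx k (N m l)) v v m - bap (fun m k l => dx l (N m k)) v v m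
        - bap (fun m k l => G (B m k l)) v v m
        + 2 * bap (fun m k l => ∑ p, N p l * B m k p) v v m
        - bap (fun m k l => ∑ j, B m j l * N j k) v v m
        - bap (fun m k l => ∑ j, N m j * B j k l) v v m := by
      simp only [key]
      simp only [bap]
      simp only [Finset.mul_sum (a := (2 : A)) (s := Finset.univ) (f := fun k => ∑ l, _),
        ← Finset.sum_sub_distrib, ← Finset.sum_add_distrib]
      refine Finset.sum_congr rfl fun i _ => ?_
      rw [Finset.mul_sum, Finset.mul_sum]
      simp only [← Finset.sum_sub_distrib, ← Finset.sum_add_distrib]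
      refine Finset.sum_congr rfl fun j _ => ?_
      ring
    rw [a5, a1, a2, a3, a4, sB v w]; ring
  have hL : T3 (fun i j k => dy k (Rl i j)) v v v =
      2 * T3 C v v (ap R v) + T2 g (bap (fun m k l => dy l (R m k)) v v) v := by
    have h0 : (fun i j k => dy k (Rl i j)) = fun i j k =>
        2 * (∑ m, R m j * C i m k) + ∑ m, dy k (R m j) * g m i := by
      funext i j k
      rw [hRl]
      simp only [map_sum, Derivation.leibniz, smul_eq_mul, hC, Finset.sum_add_distrib]
      rw [add_comm, Finset.mul_sum]
      congr 1
      · exact Finset.sum_congr rfl fun m _ => by rw [hC12 m i k]; ring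
      · exact Finset.sum_congr rfl fun m _ => by ring
    rw [h0, T3_comb2, T3_mul, T3_N2, T3_B2 (fun m j k => dy k (R m j)), s23 v (ap R v) v]
  rw [hL, hC2c, hVR, T2_comb]
  have hCR : T3 C v v (ap R v) = 2 * T3 C v v (ap (fun m k => dx k (S m)) v)
      - T3 C (ap (fun m j => G (N m j)) v) v v - T3 C (ap N w) v v := by
    rw [s23, s12, hRv, T3_comb, s12 (ap (fun m k => dx k (S m)) v), s23 v _ v]
  have K2 := K w v v
  rw [← hw, ← hq, s23 w v w, s12 w w v] at K2
  simp only [hC1c, ← hw]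
  rw [hCR, sGC v w v, sGC2 v v w, sGC v w v, s12 v (ap N w) v, s23 v v (ap N w),
    s12 v (ap N w) v, s23 w v w, s12 v w w, s23 w v w]
  rw [sg w q] at hGgc
  linear_combination hG1 + 2 * hGgc - hGX - 2 * K2

/-- The Euler-Lagrange form of the algebraic core. -/
theorem alg_EL [DecidableEq ι] (dx dy : ι → Derivation ℝ A A)
    (y S v : ι → A) (L : A) (G : Derivation ℝ A A)
    (N g R Rl : ι → ι → A) (C C1 C2 : ι → ι → ι → A)
    (hvG : ∀ (D : Derivation ℝ A A) i, D (v i) = 0)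
    (hyx : ∀ i j f, dy i (dx j f) = dx j (dy i f))
    (hyy : ∀ i j f, dy i (dy j f) = dy j (dy i f))
    (hxx : ∀ i j f, dx i (dx j f) = dx j (dx i f))
    (hdxy : ∀ i j, dx i (y j) = 0) (hdyy : ∀ i j, dy i (y j) = if i = j then 1 else 0)
    (hG : ∀ f, G f = (∑ i, y i * dx i f) - 2 * ∑ i, S i * dy i f)
    (hg : ∀ i j, dy i (dy j L) = 2 * g i j)
    (hC4 : ∀ i j k, dy i (dy j (dy k L)) = 4 * C i j k)
    (hS : ∀ l, 4 * ∑ i, g i l * S i = (∑ k, dx k (dy l L) * y k) - dx l L)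
    (hN : ∀ m i, dy i (S m) = N m i)
    (hC1 : ∀ i j k, C1 i j k = G (C i j k) - (∑ m, N m i * C m j k)
      - (∑ m, N m j * C i m k) - ∑ m, N m k * C i j m)
    (hC2 : ∀ i j k, C2 i j k = G (C1 i j k) - (∑ m, N m i * C1 m j k)
      - (∑ m, N m j * C1 i m k) - ∑ m, N m k * C1 i j m)
    (hR : ∀ m k, R m k = 2 * dx k (S m) - G (N m k) - ∑ j, N m j * N j k)
    (hRl : ∀ j k, Rl j k = ∑ i, g i j * R i k) :
    T3 (fun i j k => dy k (Rl i j)) v v v = T3 C v v (ap R v) - T3 C2 v v v := by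
  have c2 : ∀ a b : A, 2 * a = 2 * b → a = b := by
    intro a b h
    have h2 : (1 / 2 : ℝ) • (2 * a) = (1 / 2 : ℝ) • (2 * b) := by rw [h]
    have : ∀ a : A, (1 / 2 : ℝ) • (2 * a) = a := fun a => by
      rw [two_mul, smul_add, ← add_smul]; norm_num
    rwa [this, this] at h2
  have t2 : ∀ (D : Derivation ℝ A A) f, D (2 * f) = 2 * D f := fun D f => by
    rw [two_mul, map_add, two_mul]
  have hgs : ∀ i j, g i j = g j i := fun i j => c2 _ _ (by rw [← hg, ← hg, hyy])
  have hyG : ∀ k f, dy k (G f) = G (dy k f) + dx k f - 2 * ∑ m, N m k * dy m f := by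
    intro k f
    have e1 : ∑ i, dx i f * dy k (y i) = dx k f := by simp [hdyy]
    rw [hG, hG, map_sub, t2, map_sum, map_sum]
    simp only [Derivation.leibniz, smul_eq_mul, Finset.sum_add_distrib, e1, hN]
    have e2 : ∑ i, dy i f * N i k = ∑ m, N m k * dy m f :=
      Finset.sum_congr rfl fun m _ => by ring
    have e3 : ∑ i, y i * dy k (dx i f) = ∑ i, y i * dx i (dy k f) :=
      Finset.sum_congr rfl fun m _ => by rw [hyx]
    have e4 : ∑ i, S i * dy k (dy i f) = ∑ i, S i * dy i (dy k f) :=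
      Finset.sum_congr rfl fun m _ => by rw [hyy]
    rw [e2, e3, e4]; ring
  have hxG : ∀ k f, dx k (G f) = G (dx k f) - 2 * ∑ m, dx k (S m) * dy m f := by
    intro k f
    rw [hG, hG, map_sub, t2, map_sum, map_sum]
    simp only [Derivation.leibniz, smul_eq_mul, Finset.sum_add_distrib, hdxy, mul_zero]
    have e2 : ∑ i, dy i f * dx k (S i) = ∑ m, dx k (S m) * dy m f :=
      Finset.sum_congr rfl fun m _ => by ring
    have e3 : ∑ i, y i * dx k (dx i f) = ∑ i, y i * dx i (dx k f) :=
      Finset.sum_congr rfl fun m _ => by rw [hxx]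
    have e4 : ∑ i, S i * dx k (dy i f) = ∑ i, S i * dy i (dx k f) :=
      Finset.sum_congr rfl fun m _ => by rw [hyx]
    rw [e2, e3, e4]; simp only [Finset.sum_const_zero]; ring
  have EL : ∀ l, G (dy l L) = dx l L := by
    intro l
    rw [hG]
    have e1 : ∑ i, S i * dy i (dy l L) = 2 * ∑ i, g i l * S i := by
      rw [Finset.mul_sum]
      exact Finset.sum_congr rfl fun m _ => by rw [hg]; ring
    have e2 : ∑ i, y i * dx i (dy l L) = ∑ k, dx k (dy l L) * y k :=
      Finset.sum_congr rfl fun m _ => by ring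
    rw [e1, e2]
    linear_combination -hS l
  have hGg : ∀ i j, G (g i j) = (∑ m, N m i * g m j) + ∑ m, N m j * g m i := by
    have key : ∀ i l, 2 * G (g i l) + dx i (dy l L) - 4 * (∑ m, N m i * g m l)
        = dx l (dy i L) := by
      intro i l
      have h := hyG i (dy l L)
      rw [EL, hyx, hg, t2] at h
      have e1 : ∑ m, N m i * dy m (dy l L) = 2 * ∑ m, N m i * g m l := by
        rw [Finset.mul_sum]
        exact Finset.sum_congr rfl fun m _ => by rw [hg]; ring
      rw [e1] at h
      linear_combination -h
    intro i j
    have h1 := key i j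
    have h2 := key j i
    rw [hgs j i] at h2
    apply c2; apply c2
    linear_combination h1 + h2
  have c4 : ∀ a b : A, 4 * a = 4 * b → a = b := fun a b h =>
    c2 _ _ (c2 _ _ (by linear_combination h))
  have hC23 : ∀ i j k, C i j k = C i k j := fun i j k => c4 _ _ (by
    rw [← hC4, ← hC4, hyy j k])
  have hC12 : ∀ i j k, C i j k = C j i k := fun i j k => c4 _ _ (by
    rw [← hC4, ← hC4, hyy i j])
  have hC : ∀ i j k, dy k (g i j) = 2 * C i j k := fun i j k => c2 _ _ (by
    rw [← t2, ← hg, hC4, hC12, hC23]; ring)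
  exact c2 _ _ (alg_core dx dy G S N (fun m i k => dy k (N m i)) g C C1 C2 R Rl v (hvG G) hyx hyG hxG
    hN (fun _ _ _ => rfl) (fun m i k => by rw [← hN, ← hN, hyy]) hgs hC hC12 hC23 hGg hC1 hC2
    hR hRl)

end Alg

section Ana

open scoped ContDiff

variable {n : ℕ} {U : Set (E n)}

/-- The slit bundle. -/
def Om (U : Set (E n)) : Set (E n × E n) := U ×ˢ {y : E n | y ≠ 0}

lemma Om_open (hU : IsOpen U) : IsOpen (Om U) := hU.prod isOpen_ne

/-- Smooth functions of `(x,y)`. -/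
def Sm (U : Set (E n)) (f : E n → E n → ℝ) : Prop :=
  ContDiffOn ℝ ∞ (fun p : E n × E n => f p.1 p.2) (Om U)

/-- The algebra of smooth functions on the slit bundle. -/
def Alg (U : Set (E n)) : Subalgebra ℝ (Om U → ℝ) where
  carrier := {f | ∃ f' : E n × E n → ℝ, ContDiffOn ℝ ∞ f' (Om U) ∧ ∀ p : Om U, f p = f' p}
  mul_mem' := by
    rintro f g ⟨f', hf, hf'⟩ ⟨g', hg, hg'⟩
    exact ⟨fun p => f' p * g' p, hf.mul hg, fun p => by simp [hf', hg']⟩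
  add_mem' := by
    rintro f g ⟨f', hf, hf'⟩ ⟨g', hg, hg'⟩
    exact ⟨fun p => f' p + g' p, hf.add hg, fun p => by simp [hf', hg']⟩
  algebraMap_mem' := fun r => ⟨fun _ => r, contDiffOn_const, fun p => by simp⟩

/-- An extension of an element of the algebra. -/
def aext (f : Alg U) : E n × E n → ℝ := Classical.choose f.2

lemma aext_smooth (f : Alg U) : ContDiffOn ℝ ∞ (aext f) (Om U) := (Classical.choose_spec f.2).1

lemma aext_eq (f : Alg U) (p : Om U) : f.1 p = aext f p := (Classical.choose_spec f.2).2 p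

lemma smooth_fderiv (hU : IsOpen U) {f : E n × E n → ℝ} (hf : ContDiffOn ℝ ∞ f (Om U))
    (u : E n × E n) : ContDiffOn ℝ ∞ (fun p => fderiv ℝ f p u) (Om U) :=
  (hf.fderiv_of_isOpen (Om_open hU) (by simp)).clm_apply contDiffOn_const

lemma smooth_diff (hU : IsOpen U) {f : E n × E n → ℝ} (hf : ContDiffOn ℝ ∞ f (Om U))
    {p : E n × E n} (hp : p ∈ Om U) : DifferentiableAt ℝ f p :=
  ((hf.contDiffAt ((Om_open hU).mem_nhds hp)).differentiableAt (by simp))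

lemma fderiv_aext (hU : IsOpen U) (f : Alg U) (f' : E n × E n → ℝ)
    (h : ∀ p : Om U, f.1 p = f' p) (p : Om U) :
    fderiv ℝ (aext f) p = fderiv ℝ f' p := by
  apply Filter.EventuallyEq.fderiv_eq
  filter_upwards [(Om_open hU).mem_nhds p.2] with q hq
  rw [← aext_eq f ⟨q, hq⟩, h ⟨q, hq⟩]

/-- Directional derivative on the algebra. -/
def Dv (hU : IsOpen U) (u : E n × E n) : Derivation ℝ (Alg U) (Alg U) :=
  Derivation.mk'
    { toFun := fun f => ⟨fun p => fderiv ℝ (aext f) p u,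
        ⟨fun p => fderiv ℝ (aext f) p u, smooth_fderiv hU (aext_smooth f) u, fun _ => rfl⟩⟩
      map_add' := by
        intro f g
        apply Subtype.ext
        funext p
        have h1 := fderiv_aext hU (f + g) (aext f + aext g) (fun p => by
          simp [← aext_eq]) p
        simp only [h1, fderiv_add (smooth_diff hU (aext_smooth f) p.2)
          (smooth_diff hU (aext_smooth g) p.2)]
        simp
      map_smul' := by
        intro r f
        apply Subtype.ext
        funext p
        have h1 := fderiv_aext hU (r • f) (r • aext f) (fun p => by
          simp [← aext_eq]) p
        simp only [h1, fderiv_const_smul (smooth_diff hU (aext_smooth f) p.2)]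
        simp }
    (by
      intro f g
      apply Subtype.ext
      funext p
      have h1 := fderiv_aext hU (f * g) (aext f * aext g) (fun p => by
          simp [← aext_eq]) p
      have h2 := fderiv_mul (smooth_diff hU (aext_smooth f) p.2)
          (smooth_diff hU (aext_smooth g) p.2)
      simp only [LinearMap.coe_mk, AddHom.coe_mk, h1, h2]
      simp [← aext_eq])

lemma Dv_apply (hU : IsOpen U) (u : E n × E n) (f : Alg U) (f' : E n × E n → ℝ)
    (h : ∀ p : Om U, f.1 p = f' p) (p : Om U) : (Dv hU u f).1 p = fderiv ℝ f' p u := by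
  rw [← fderiv_aext hU f f' h p]; rfl

lemma Dv_comm (hU : IsOpen U) (u w : E n × E n) (f : Alg U) :
    Dv hU u (Dv hU w f) = Dv hU w (Dv hU u f) := by
  apply Subtype.ext
  funext p
  have hs := (aext_smooth f).contDiffAt ((Om_open hU).mem_nhds p.2)
  have hsym : IsSymmSndFDerivAt ℝ (aext f) (p : E n × E n) :=
    hs.isSymmSndFDerivAt (by simp; exact WithTop.coe_le_coe.mpr (le_top : (2 : ℕ∞) ≤ ⊤))
  have hd : DifferentiableAt ℝ (fderiv ℝ (aext f)) (p : E n × E n) :=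
    (hs.fderiv_right (m := ∞) (by simp)).differentiableAt (by simp)
  have key : ∀ u w, (Dv hU u (Dv hU w f)).1 p = fderiv ℝ (fderiv ℝ (aext f)) p u w := by
    intro u w
    rw [Dv_apply hU u (Dv hU w f) (fun q => fderiv ℝ (aext f) q w) (fun q => rfl) p]
    rw [fderiv_clm_apply hd (differentiableAt_const w)]
    simp
  rw [key, key, hsym.eq]

/-- A smooth function as an element of the algebra. -/
def mkA (f : E n → E n → ℝ) (hf : Sm U f) : Alg U :=
  ⟨fun p => f p.1.1 p.1.2, ⟨fun p => f p.1 p.2, hf, fun _ => rfl⟩⟩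

lemma mkA_apply (f : E n → E n → ℝ) (hf : Sm U f) (p : Om U) :
    (mkA f hf).1 p = f p.1.1 p.1.2 := rfl

lemma two_val (p : Om U) : (2 : Alg U).1 p = 2 := rfl

lemma four_val (p : Om U) : (4 : Alg U).1 p = 4 := rfl

lemma der_sum {A : Type*} [CommRing A] [Algebra ℝ A] (D : Fin n → Derivation ℝ A A) (f : A) :
    (∑ i, D i) f = ∑ i, D i f := by
  have := congrFun (map_sum (Derivation.coeFnAddMonoidHom (R := ℝ) (A := A) (M := A)) D
    Finset.univ) f
  rw [Finset.sum_apply] at this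
  exact this

lemma pdy_eq (hU : IsOpen U) {f : E n → E n → ℝ} (hf : Sm U f) (i : Fin n) {p : E n × E n}
    (hp : p ∈ Om U) :
    pdy n f i p.1 p.2 = fderiv ℝ (fun p : E n × E n => f p.1 p.2) p (0, e n i) := by
  have h := (smooth_diff hU hf hp).hasFDerivAt
  have h2 := HasFDerivAt.comp (f := fun y => (p.1, y)) p.2 h (hasFDerivAt_prodMk_right p.1 p.2)
  have h3 : fderiv ℝ (f p.1) p.2 = _ := h2.fderiv
  rw [pdy, h3]; simp

lemma pdx_eq (hU : IsOpen U) {f : E n → E n → ℝ} (hf : Sm U f) (i : Fin n) {p : E n × E n}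
    (hp : p ∈ Om U) :
    pdx n f i p.1 p.2 = fderiv ℝ (fun p : E n × E n => f p.1 p.2) p (e n i, 0) := by
  have h := (smooth_diff hU hf hp).hasFDerivAt
  have h2 := HasFDerivAt.comp (f := fun x => (x, p.2)) p.1 h (hasFDerivAt_prodMk_left p.1 p.2)
  have h3 : fderiv ℝ (fun x' => f x' p.2) p.1 = _ := h2.fderiv
  rw [pdx, h3]; simp

lemma Sm.pdy (hU : IsOpen U) {f : E n → E n → ℝ} (hf : Sm U f) (i : Fin n) :
    Sm U (pdy n f i) :=
  (smooth_fderiv hU hf (0, e n i)).congr fun _ hp => pdy_eq hU hf i hp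

lemma Sm.pdx (hU : IsOpen U) {f : E n → E n → ℝ} (hf : Sm U f) (i : Fin n) :
    Sm U (pdx n f i) :=
  (smooth_fderiv hU hf (e n i, 0)).congr fun _ hp => pdx_eq hU hf i hp

lemma Dv_y (hU : IsOpen U) {f : E n → E n → ℝ} (hf : Sm U f) (i : Fin n) :
    Dv hU (0, e n i) (mkA f hf) = mkA (pdy n f i) (hf.pdy hU i) := by
  apply Subtype.ext
  funext p
  rw [mkA_apply, pdy_eq hU hf i p.2, Dv_apply hU _ _ (fun p => f p.1 p.2) (fun q => rfl)]

lemma Dv_x (hU : IsOpen U) {f : E n → E n → ℝ} (hf : Sm U f) (i : Fin n) :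
    Dv hU (e n i, 0) (mkA f hf) = mkA (pdx n f i) (hf.pdx hU i) := by
  apply Subtype.ext
  funext p
  rw [mkA_apply, pdx_eq hU hf i p.2, Dv_apply hU _ _ (fun p => f p.1 p.2) (fun q => rfl)]

lemma Sm_coord (i : Fin n) : Sm U (fun _ y => y i) := by
  unfold Sm
  fun_prop

lemma Sm_sum {f : Fin n → E n → E n → ℝ} (hf : ∀ i, Sm U (f i)) :
    Sm U (fun x y => ∑ i, f i x y) :=
  ContDiffOn.sum fun i _ => hf i

lemma Sm.mul {f g : E n → E n → ℝ} (hf : Sm U f) (hg : Sm U g) :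
    Sm U (fun x y => f x y * g x y) := ContDiffOn.mul hf hg

lemma Sm.add {f g : E n → E n → ℝ} (hf : Sm U f) (hg : Sm U g) :
    Sm U (fun x y => f x y + g x y) := ContDiffOn.add hf hg

lemma Sm.sub {f g : E n → E n → ℝ} (hf : Sm U f) (hg : Sm U g) :
    Sm U (fun x y => f x y - g x y) := ContDiffOn.sub hf hg

lemma Sm_const (r : ℝ) : Sm U (fun _ _ => r) := contDiffOn_const

lemma Sm_det {M : E n → E n → Matrix (Fin n) (Fin n) ℝ}
    (hM : ∀ i j, Sm U (fun x y => M x y i j)) : Sm U (fun x y => (M x y).det) := by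
  unfold Sm
  simp only [Matrix.det_apply]
  refine ContDiffOn.sum fun σ _ => ?_
  refine ContDiffOn.const_smul _ ?_
  exact contDiffOn_prod fun i _ => hM _ _

lemma Sm_F2 {F : E n → E n → ℝ} (hF : IsFinsler n U F) : Sm U (F2 n F) := hF.smooth.pow 2

lemma Sm_gm (hU : IsOpen U) {F : E n → E n → ℝ} (hF : IsFinsler n U F) (i j : Fin n) :
    Sm U (gm n F i j) := (Sm_const _).mul (((Sm_F2 hF).pdy hU j).pdy hU i)

lemma Sm_Cartan (hU : IsOpen U) {F : E n → E n → ℝ} (hF : IsFinsler n U F) (i j k : Fin n) :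
    Sm U (Cartan n F i j k) :=
  (Sm_const _).mul ((((Sm_F2 hF).pdy hU k).pdy hU j).pdy hU i)

lemma det_ne {F : E n → E n → ℝ} (hF : IsFinsler n U F) {p : E n × E n} (hp : p ∈ Om U) :
    (gmat n F p.1 p.2).det ≠ 0 := (hF.posdef p.1 hp.1 p.2 hp.2).det_pos.ne'

lemma Sm_ginv (hU : IsOpen U) {F : E n → E n → ℝ} (hF : IsFinsler n U F) (i j : Fin n) :
    Sm U (fun x y => ginv n F x y i j) := by
  have h1 : Sm U (fun x y => (gmat n F x y).det) := Sm_det fun i j => Sm_gm hU hF i j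
  have h2 : Sm U (fun x y => (gmat n F x y).adjugate i j) := by
    simp only [Matrix.adjugate_apply]
    refine Sm_det fun k l => ?_
    simp only [Matrix.updateRow_apply]
    split_ifs
    · exact Sm_const _
    · exact Sm_gm hU hF k l
  have h3 : Sm U (fun x y => ((gmat n F x y).det)⁻¹) := ContDiffOn.inv h1 fun p hp => det_ne hF hp
  have := h3.mul h2
  simpa [ginv, Matrix.inv_def, Ring.inverse_eq_inv'] using this

lemma Sm_Spray (hU : IsOpen U) {F : E n → E n → ℝ} (hF : IsFinsler n U F) (i : Fin n) :
    Sm U (Spray n F i) :=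
  (Sm_const _).mul (Sm_sum fun l => (Sm_ginv hU hF i l).mul
    ((Sm_sum fun k => (((Sm_F2 hF).pdy hU l).pdx hU k).mul (Sm_coord k)).sub
      ((Sm_F2 hF).pdx hU l)))

lemma Sm_RiemUp (hU : IsOpen U) {F : E n → E n → ℝ} (hF : IsFinsler n U F) (i k : Fin n) :
    Sm U (RiemUp n F i k) := by
  have hS := fun i => Sm_Spray hU hF i
  exact ((((Sm_const _).mul ((hS i).pdx hU k)).sub
    (Sm_sum fun j => (Sm_coord j).mul (((hS i).pdy hU k).pdx hU j))).add
    ((Sm_const _).mul (Sm_sum fun j => (hS j).mul (((hS i).pdy hU k).pdy hU j)))).sub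
    (Sm_sum fun j => ((hS i).pdy hU j).mul ((hS j).pdy hU k))

lemma Sm_Rlow (hU : IsOpen U) {F : E n → E n → ℝ} (hF : IsFinsler n U F) (i k : Fin n) :
    Sm U (Rlow n F i k) := Sm_sum fun j => (Sm_gm hU hF j i).mul (Sm_RiemUp hU hF j k)

lemma Sm_Gop (hU : IsOpen U) {F : E n → E n → ℝ} (hF : IsFinsler n U F) {f : E n → E n → ℝ}
    (hf : Sm U f) : Sm U (Gop n F f) :=
  (Sm_sum fun j => (Sm_coord j).mul (hf.pdx hU j)).sub
    ((Sm_const _).mul (Sm_sum fun j => (Sm_Spray hU hF j).mul (hf.pdy hU j)))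

lemma Sm_Dyn3 (hU : IsOpen U) {F : E n → E n → ℝ} (hF : IsFinsler n U F)
    {T : Fin n → Fin n → Fin n → E n → E n → ℝ} (hT : ∀ i j k, Sm U (T i j k)) (i j k : Fin n) :
    Sm U (Dyn3 n F T i j k) := by
  have hN := fun m i => (Sm_Spray hU hF m).pdy hU i
  exact (((Sm_Gop hU hF (hT i j k)).sub (Sm_sum fun m => (hN m i).mul (hT m j k))).sub
    (Sm_sum fun m => (hN m j).mul (hT i m k))).sub (Sm_sum fun m => (hN m k).mul (hT i j m))

lemma gm_symm (hU : IsOpen U) {F : E n → E n → ℝ} (hF : IsFinsler n U F) (i j : Fin n)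
    {p : E n × E n} (hp : p ∈ Om U) : gm n F i j p.1 p.2 = gm n F j i p.1 p.2 := by
  have h := Dv_comm hU (0, e n i) (0, e n j) (mkA _ (Sm_F2 hF))
  rw [Dv_y, Dv_y, Dv_y, Dv_y] at h
  have := congrFun (congrArg Subtype.val h) ⟨p, hp⟩
  simp only [mkA_apply] at this
  simp only [gm, this]

lemma spray_EL (hU : IsOpen U) {F : E n → E n → ℝ} (hF : IsFinsler n U F) (l : Fin n)
    {p : E n × E n} (hp : p ∈ Om U) :
    4 * ∑ i, gm n F i l p.1 p.2 * Spray n F i p.1 p.2 =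
      (∑ k, pdx n (pdy n (F2 n F) l) k p.1 p.2 * p.2 k) - pdx n (F2 n F) l p.1 p.2 := by
  set r : Fin n → ℝ := fun l =>
    (∑ k, pdx n (pdy n (F2 n F) l) k p.1 p.2 * p.2 k) - pdx n (F2 n F) l p.1 p.2 with hr
  have h1 : gmat n F p.1 p.2 * ginv n F p.1 p.2 = 1 :=
    Matrix.mul_nonsing_inv _ (isUnit_iff_ne_zero.mpr (det_ne hF hp))
  have h2 : (gmat n F p.1 p.2).mulVec ((ginv n F p.1 p.2).mulVec r) = r := by
    rw [Matrix.mulVec_mulVec, h1, Matrix.one_mulVec]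
  have h3 := congrFun h2 l
  rw [show _ - _ = r l from rfl, ← h3, Finset.mul_sum]
  simp only [Matrix.mulVec, dotProduct]
  refine Finset.sum_congr rfl fun i _ => ?_
  rw [gm_symm hU hF i l hp]
  simp only [Spray, gmat, Matrix.of_apply, hr]
  ring

end Ana

/-- `[R_{ij}]_{y^k} v^i v^j v^k = C_{ijm}v^iv^j R^m_k v^k - C_{ijk|0|0}v^iv^jv^k`. -/
theorem vertical_derivative_of_riemann (n : ℕ) (hn : 2 ≤ n)
    (U : Set (E n)) (hU : IsOpen U) (F : E n → E n → ℝ)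
    (hF : IsFinsler n U F) :
    ∀ x ∈ U, ∀ y : E n, y ≠ 0 → ∀ v : E n,
      (∑ i, ∑ j, ∑ k, pdy n (Rlow n F i j) k x y * v i * v j * v k) =
        (∑ i, ∑ j, ∑ m, Cartan n F i j m x y * v i * v j *
          (∑ k, RiemUp n F m k x y * v k)) -
        ∑ i, ∑ j, ∑ k, Dyn3 n F (Dyn3 n F (Cartan n F)) i j k x y * v i * v j * v k := by
  intro x hx y hy v
  let p : Om U := ⟨(x, y), hx, hy⟩
  let dx : Fin n → Derivation ℝ (Alg U) (Alg U) := fun i => Dv hU (e n i, 0)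
  let dy : Fin n → Derivation ℝ (Alg U) (Alg U) := fun i => Dv hU (0, e n i)
  let ya : Fin n → Alg U := fun i => mkA _ (Sm_coord i)
  let S : Fin n → Alg U := fun i => mkA _ (Sm_Spray hU hF i)
  let va : Fin n → Alg U := fun i => algebraMap ℝ (Alg U) (v i)
  let G : Derivation ℝ (Alg U) (Alg U) := (∑ i, ya i • dx i) - (2 : Alg U) • ∑ i, S i • dy i
  have hG : ∀ f, G f = (∑ i, ya i * dx i f) - 2 * ∑ i, S i * dy i f := by
    intro f
    simp only [G, Derivation.sub_apply, Derivation.smul_apply, smul_eq_mul,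
      der_sum]
  have hGm : ∀ f (hf : Sm U f), G (mkA f hf) = mkA (Gop n F f) (Sm_Gop hU hF hf) := by
    intro f hf
    rw [hG]
    simp only [dx, dy, Dv_x, Dv_y]
    apply Subtype.ext
    funext q
    simp [mkA, Gop, ya, S, two_val]
  let N : Fin n → Fin n → Alg U := fun m i => mkA _ ((Sm_Spray hU hF m).pdy hU i)
  have hC := Sm_Cartan hU hF
  have hC1 := Sm_Dyn3 hU hF hC
  have hC2 := Sm_Dyn3 hU hF hC1
  have main := alg_EL dx dy ya S va (mkA _ (Sm_F2 hF)) G N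
    (fun i j => mkA _ (Sm_gm hU hF i j)) (fun i j => mkA _ (Sm_RiemUp hU hF i j))
    (fun i j => mkA _ (Sm_Rlow hU hF i j)) (fun i j k => mkA _ (hC i j k))
    (fun i j k => mkA _ (hC1 i j k)) (fun i j k => mkA _ (hC2 i j k))
    (fun D i => D.map_algebraMap _)
    (fun i j f => Dv_comm hU _ _ f) (fun i j f => Dv_comm hU _ _ f)
    (fun i j f => Dv_comm hU _ _ f)
    (fun i j => by
      simp only [dx, ya, Dv_x]
      apply Subtype.ext
      funext q
      simp [mkA, pdx])
    (fun i j => by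
      simp only [dy, ya, Dv_y]
      apply Subtype.ext
      funext q
      have : fderiv ℝ (fun y : E n => y j) q.1.2 = ContinuousLinearMap.proj j :=
        (ContinuousLinearMap.proj (R := ℝ) (φ := fun _ : Fin n => ℝ) j).fderiv
      simp only [mkA, pdy, this, e]
      by_cases h : i = j
      · subst h; simp
      · simp [h, Ne.symm h])
    hG
    (fun i j => by
      simp only [dy, Dv_y]
      apply Subtype.ext
      funext q
      simp [mkA, gm, two_val])
    (fun i j k => by
      simp only [dy, Dv_y]
      apply Subtype.ext
      funext q
      simp [mkA, Cartan, four_val])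
    (fun l => by
      simp only [dx, dy, Dv_y, Dv_x]
      apply Subtype.ext
      funext q
      have := spray_EL hU hF l q.2
      simpa [mkA, S, ya, four_val] using this)
    (fun m i => by simp only [dy, S, N, Dv_y])
    (fun i j k => by
      rw [hGm]
      apply Subtype.ext
      funext q
      simp [mkA, Dyn3, N])
    (fun i j k => by
      rw [hGm]
      apply Subtype.ext
      funext q
      simp [mkA, Dyn3, N])
    (fun m k => by
      simp only [N, hGm, dx, S, Dv_x]
      apply Subtype.ext
      funext q
      simp [mkA, RiemUp, Gop, two_val]
      ring)
    (fun j k => by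
      apply Subtype.ext
      funext q
      simp [mkA, Rlow])
  have fin := congrFun (congrArg Subtype.val main) p
  simp only [dy, Dv_y] at fin
  simpa [T3, ap, mkA, va, p] using fin

end Paper
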